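/- arXiv:2111.14417 — 2 statements merged into one kernel-verified Lean document; each statement's English description precedes it below -/
import Mathlib

section
/- If an SDR C satisfies top monotonicity (TM) and top rationality (TR), then for all profiles R,Q and all distinct alternatives x,y: if R_i and Q_i induce the same ranking on {x,y} for every voter i (i.e., x is strictly preferred, strictly dispreferred, or indifferent to y in R_i exactly when the same holds in Q_i), then C(R^{x,y}) = C(Q^{x,y}). -/
/-- A weak order on `A`: a complete (total) and transitive binary relation. -/
structure WeakOrd (A : Type*) where
  rel : A → A → Prop
  total : ∀ x y, rel x y ∨ rel y x
  trans : ∀ x y z, rel x y → rel y z → rel x z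

namespace WeakOrd

variable {A : Type*}

/-- Strict preference. -/
def strict (r : WeakOrd A) (x y : A) : Prop := r.rel x y ∧ ¬ r.rel y x

/-- Indifference. -/
def indiff (r : WeakOrd A) (x y : A) : Prop := r.rel x y ∧ r.rel y x

open Classical in
/-- The weak order obtained from `r` by moving `x` and `y` strictly above all other
alternatives, preserving the relative ranking of `x` and `y` and of the rest. -/
noncomputable def topShift (r : WeakOrd A) (x y : A) : WeakOrd A where
  rel a b :=
    if a = x ∨ a = y then (if b = x ∨ b = y then r.rel a b else True)
    else if b = x ∨ b = y then False else r.rel a b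
  total := by
    intro a b
    by_cases ha : a = x ∨ a = y <;> by_cases hb : b = x ∨ b = y <;>
      simp [ha, hb, r.total a b]
  trans := by
    intro a b c hab hbc
    by_cases ha : a = x ∨ a = y <;> by_cases hb : b = x ∨ b = y <;>
      by_cases hc : c = x ∨ c = y <;> simp_all <;>
      exact r.trans _ _ _ hab hbc

/-- Relabelling the alternatives of a weak order by a permutation `σ`:
`a` is weakly preferred to `b` in `σ(r)` iff `σ⁻¹ a` is weakly preferred to `σ⁻¹ b` in `r`. -/
def map (σ : Equiv.Perm A) (r : WeakOrd A) : WeakOrd A where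
  rel a b := r.rel (σ.symm a) (σ.symm b)
  total := fun _ _ => r.total _ _
  trans := fun _ _ _ hab hbc => r.trans _ _ _ hab hbc

end WeakOrd

/-- A (preference) profile: a weak order for each voter. -/
abbrev Profile (N A : Type*) := N → WeakOrd A

namespace Profile

variable {N A : Type*}

/-- The top-shift profile `R^{x,y}`. -/
noncomputable def topShift (R : Profile N A) (x y : A) : Profile N A :=
  fun i => (R i).topShift x y

/-- Relabelling alternatives in every voter's preference by a permutation `σ`. -/
def map (σ : Equiv.Perm A) (R : Profile N A) : Profile N A := fun i => (R i).map σ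

end Profile

/-- `nwins R x y` is `n(x,y,R)`, the number of voters strictly preferring `x` to `y`. -/
noncomputable def nwins {N A : Type*} (R : Profile N A) (x y : A) : ℕ :=
  Nat.card {i // (R i).strict x y}

/-- The set of Condorcet winners of `R`. -/
def CW {N A : Type*} (R : Profile N A) : Set A :=
  {x | ∀ y, y ≠ x → nwins R y x ≤ nwins R x y}

/-- Condorcet consistency of a social decision rule. -/
def CondorcetConsistent {N A : Type*} (C : Profile N A → Set A) : Prop :=
  ∀ R : Profile N A, (CW R).Nonempty → C R = CW R

/-- The nice set `N_C(R)`: alternatives selected each time they are top-shifted with any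
other alternative. -/
def niceSet {N A : Type*} (C : Profile N A → Set A) (R : Profile N A) : Set A :=
  {x | ∀ y, y ≠ x → x ∈ C (R.topShift x y)}

/-- Weak top consistency (WTC). -/
def WeakTopConsistency {N A : Type*} (C : Profile N A → Set A) : Prop :=
  ∀ R : Profile N A, niceSet C R ⊆ C R

/-- Top consistency (TC). -/
def TopConsistency {N A : Type*} (C : Profile N A → Set A) : Prop :=
  ∀ R : Profile N A, (niceSet C R).Nonempty → C R = niceSet C R

/-- A 2-profile: two alternatives are unanimously strictly preferred to all others. -/
def IsTwoProfile {N A : Type*} (R : Profile N A) : Prop :=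
  ∃ x y : A, x ≠ y ∧
    ∀ z, z ≠ x → z ≠ y → ∀ i, (R i).strict x z ∧ (R i).strict y z

/-- Top anonymity (TA). -/
def TopAnonymity {N A : Type*} (C : Profile N A → Set A) : Prop :=
  ∀ R : Profile N A, IsTwoProfile R → ∀ π : Equiv.Perm N, C (fun i => R (π i)) = C R

/-- Top neutrality (TN). -/
def TopNeutrality {N A : Type*} (C : Profile N A → Set A) : Prop :=
  ∀ R : Profile N A, IsTwoProfile R → ∀ σ : Equiv.Perm A, C (Profile.map σ R) = σ '' (C R)

/-- Top symmetry (TS): top anonymity and top neutrality. -/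
def TopSymmetry {N A : Type*} (C : Profile N A → Set A) : Prop :=
  TopAnonymity C ∧ TopNeutrality C

/-- `Improves R Q x z`, i.e. `R ▷^{x,z} Q`: `Q` is an additional support of `x`
against `z` from `R` to `Q`. -/
def Improves {N A : Type*} (R Q : Profile N A) (x z : A) : Prop :=
  (∀ i w, ((R i).strict x w → (Q i).strict x w) ∧ ((R i).indiff x w → (Q i).rel x w)) ∧
  ∃ i, (R i).rel z x ∧ (Q i).strict x z

/-- Top monotonicity (TM). -/
def TopMonotonicity {N A : Type*} (C : Profile N A → Set A) : Prop :=
  ∀ (R Q : Profile N A) (x y z : A), x ≠ y → z ≠ x →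
    x ∈ C (R.topShift x y) → Improves R Q x z →
    x ∈ C (Q.topShift x y) ∧ z ∉ C (Q.topShift x y)

/-- Top rationality (TR). -/
def TopRationality {N A : Type*} (C : Profile N A → Set A) : Prop :=
  ∀ (R : Profile N A) (x y : A), x ≠ y → (C (R.topShift x y) ∩ {x, y}).Nonempty

/-- Maskin monotonicity (MM). -/
def MaskinMonotonic {N A : Type*} (C : Profile N A → Set A) : Prop :=
  ∀ (R Q : Profile N A) (x : A), x ∈ C R →
    (∀ i y, ((R i).strict x y → (Q i).strict x y) ∧ ((R i).indiff x y → (Q i).rel x y)) →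
    x ∈ C Q

namespace WeakOrd

variable {A : Type*}

theorem eq_of_rel_iff {r s : WeakOrd A} (h : ∀ a b, r.rel a b ↔ s.rel a b) : r = s := by
  cases r
  cases s
  congr
  funext a b
  exact propext (h a b)

theorem rel_refl (r : WeakOrd A) (x : A) : r.rel x x := (r.total x x).elim id id

open Classical in
/-- The weak order obtained from `r` by moving `x` and `y` strictly below all other
alternatives, preserving the relative ranking of `x` and `y` and of the rest. -/
noncomputable def bottomShift (r : WeakOrd A) (x y : A) : WeakOrd A where
  rel a b :=
    if a = x ∨ a = y then (if b = x ∨ b = y then r.rel a b else False)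
    else if b = x ∨ b = y then True else r.rel a b
  total := by
    intro a b
    by_cases ha : a = x ∨ a = y <;> by_cases hb : b = x ∨ b = y <;>
      simp [ha, hb, r.total a b]
  trans := by
    intro a b c hab hbc
    by_cases ha : a = x ∨ a = y <;> by_cases hb : b = x ∨ b = y <;>
      by_cases hc : c = x ∨ c = y <;> simp_all <;>
      exact r.trans _ _ _ hab hbc

theorem topShift_comm (r : WeakOrd A) (x y : A) : r.topShift x y = r.topShift y x :=
  eq_of_rel_iff fun a b => by
    by_cases a = x <;> by_cases a = y <;> by_cases b = x <;> by_cases b = y <;>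
      simp_all [topShift]

theorem topShift_topShift (r : WeakOrd A) (x y : A) :
    (r.topShift x y).topShift x y = r.topShift x y :=
  eq_of_rel_iff fun a b => by
    by_cases ha : a = x ∨ a = y <;> by_cases hb : b = x ∨ b = y <;> simp [topShift, ha, hb]

theorem topShift_bottomShift (r : WeakOrd A) (x y : A) :
    (r.bottomShift x y).topShift x y = r.topShift x y :=
  eq_of_rel_iff fun a b => by
    by_cases ha : a = x ∨ a = y <;> by_cases hb : b = x ∨ b = y <;>
      simp +contextual [topShift, bottomShift, ha, hb]

end WeakOrd

theorem Profile.topShift_comm {N A : Type*} (R : Profile N A) (x y : A) :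
    R.topShift x y = R.topShift y x :=
  funext fun i => (R i).topShift_comm x y

/-- If `x` does at least as well against `y` in `Q` as in `R`, then passing from the
bottom-shift of `R` to the top-shift of `Q` is an additional support of `x` against any
third alternative. -/
theorem improves_bottomShift_topShift {N A : Type*} [Nonempty N] {R Q : Profile N A}
    {x y z : A} (hzx : z ≠ x) (hzy : z ≠ y)
    (hs : ∀ i, (R i).strict x y → (Q i).strict x y)
    (hi : ∀ i, (R i).indiff x y → (Q i).indiff x y) :
    Improves (fun i => (R i).bottomShift x y) (Q.topShift x y) x z := by
  refine ⟨fun i w => ?_, Classical.arbitrary N, ?_, ?_⟩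
  · have hsi := hs i
    have hii := hi i
    have hR := (R i).rel_refl x
    have hQ := (Q i).rel_refl x
    by_cases hwx : w = x
    · subst hwx
      simp_all [WeakOrd.strict, WeakOrd.bottomShift, WeakOrd.topShift, Profile.topShift]
    · by_cases hwy : w = y
      · subst hwy
        simp_all [WeakOrd.strict, WeakOrd.indiff, WeakOrd.bottomShift, WeakOrd.topShift,
          Profile.topShift]
      · simp [WeakOrd.strict, WeakOrd.indiff, WeakOrd.bottomShift, WeakOrd.topShift,
          Profile.topShift, hwx, hwy]
  · simp [WeakOrd.bottomShift, hzx, hzy]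
  · simp [WeakOrd.strict, WeakOrd.topShift, Profile.topShift, hzx, hzy]

theorem TopMonotonicity.mem_topShift {N A : Type*} [Nonempty N] {C : Profile N A → Set A}
    (hTM : TopMonotonicity C) {R Q : Profile N A} {x y z : A} (hxy : x ≠ y)
    (hzx : z ≠ x) (hzy : z ≠ y)
    (hs : ∀ i, (R i).strict x y → (Q i).strict x y)
    (hi : ∀ i, (R i).indiff x y → (Q i).indiff x y)
    (hx : x ∈ C (R.topShift x y)) :
    x ∈ C (Q.topShift x y) ∧ z ∉ C (Q.topShift x y) := by
  have hR : Profile.topShift (fun i => (R i).bottomShift x y) x y = R.topShift x y :=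
    funext fun i => (R i).topShift_bottomShift x y
  have hQ : (Q.topShift x y).topShift x y = Q.topShift x y :=
    funext fun i => (Q i).topShift_topShift x y
  rw [← hQ]
  exact hTM _ _ x y z hxy hzx (hR ▸ hx) (improves_bottomShift_topShift hzx hzy hs hi)

theorem TopMonotonicity.topShift_subset {N A : Type*} [Nonempty N] [Fintype A]
    (hA : 3 ≤ Fintype.card A) {C : Profile N A → Set A}
    (hTM : TopMonotonicity C) (hTR : TopRationality C) {R Q : Profile N A} {x y : A}
    (hxy : x ≠ y)
    (hs : ∀ i, (R i).strict x y → (Q i).strict x y)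
    (hs' : ∀ i, (R i).strict y x → (Q i).strict y x)
    (hi : ∀ i, (R i).indiff x y → (Q i).indiff x y) :
    C (R.topShift x y) ⊆ C (Q.topShift x y) := by
  have hi' : ∀ i, (R i).indiff y x → (Q i).indiff y x := fun i h => (hi i h.symm).symm
  obtain ⟨z, hzx, hzy⟩ : ∃ z, z ≠ x ∧ z ≠ y := by
    classical
    have hcard : ({x, y} : Finset A).card < Fintype.card A :=
      Finset.card_le_two.trans_lt hA
    obtain ⟨z, hz⟩ := Finset.exists_mem_notMem_of_card_lt_card
      (hcard.trans_eq Finset.card_univ.symm)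
    exact ⟨z, by simpa using hz⟩
  intro a ha
  by_cases hax : a = x
  · subst hax
    exact (hTM.mem_topShift hxy hzx hzy hs hi ha).1
  by_cases hay : a = y
  · subst hay
    rw [Profile.topShift_comm] at ha ⊢
    exact (hTM.mem_topShift hxy.symm hzy hzx hs' hi' ha).1
  obtain ⟨b, hb, rfl | rfl⟩ := hTR R x y hxy
  · exact absurd ha (hTM.mem_topShift hxy hax hay (fun _ => id) (fun _ => id) hb).2
  · rw [Profile.topShift_comm] at ha hb
    exact absurd ha (hTM.mem_topShift hxy.symm hay hax (fun _ => id) (fun _ => id) hb).2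

/-- If an SDR satisfies TM and TR, then whenever two profiles induce
the same individual rankings on `{x, y}`, the corresponding top-shift profiles have
the same winning set. -/
theorem stmt_4 {N A : Type*} [Fintype N] [Fintype A]
    (hN : 2 ≤ Fintype.card N) (hA : 3 ≤ Fintype.card A)
    (C : Profile N A → Set A) (hCne : ∀ R, (C R).Nonempty)
    (hTM : TopMonotonicity C) (hTR : TopRationality C) :
    ∀ (R Q : Profile N A) (x y : A), x ≠ y →
      (∀ i : N, ((R i).strict x y ↔ (Q i).strict x y) ∧
        ((R i).strict y x ↔ (Q i).strict y x) ∧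
        ((R i).indiff x y ↔ (Q i).indiff x y)) →
      C (R.topShift x y) = C (Q.topShift x y) := by
  intro R Q x y hxy h
  have : Nonempty N := Fintype.card_pos_iff.mp (by omega)
  exact Set.Subset.antisymm
    (hTM.topShift_subset hA hTR hxy (fun i => (h i).1.mp) (fun i => (h i).2.1.mp)
      (fun i => (h i).2.2.mp))
    (hTM.topShift_subset hA hTR hxy (fun i => (h i).1.mpr) (fun i => (h i).2.1.mpr)
      (fun i => (h i).2.2.mpr))
end

section
/- Top consistency cannot be dropped from the characterization: there exists an SDR that satisfies weak top consistency (WTC), top anonymity (TA), top neutrality (TN), top monotonicity (TM) and top rationality (TR) but is not Condorcet-consistent; a witness is C₁ defined by C₁(R) = CW(R) if R is a 2-profile and C₁(R) = A otherwise. -/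
open Classical in
/-- The rule `C₁`: the Condorcet winners on 2-profiles, everything otherwise. -/
noncomputable def C1 {N A : Type*} (R : Profile N A) : Set A :=
  if IsTwoProfile R then CW R else Set.univ

section TopPairs

variable {N A : Type*}

theorem WeakOrd.not_rel_iff_strict (r : WeakOrd A) (x y : A) : ¬ r.rel y x ↔ r.strict x y :=
  ⟨fun h => ⟨(r.total x y).resolve_right h, h⟩, fun h => h.2⟩

theorem WeakOrd.strict_asymm {r : WeakOrd A} {x y : A} (h : r.strict x y) : ¬ r.strict y x :=
  fun h' => h.2 h'.1

theorem WeakOrd.strict_topShift_left (r : WeakOrd A) (x y : A) :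
    (r.topShift x y).strict x y ↔ r.strict x y := by
  simp [strict, topShift]

theorem WeakOrd.strict_topShift_right (r : WeakOrd A) (x y : A) :
    (r.topShift x y).strict y x ↔ r.strict y x := by
  simp [strict, topShift]

theorem WeakOrd.topShift_strict_of_ne (r : WeakOrd A) {x y z : A} (hzx : z ≠ x) (hzy : z ≠ y) :
    (r.topShift x y).strict x z ∧ (r.topShift x y).strict y z := by
  simp [strict, topShift, hzx, hzy]

theorem nwins_topShift_left (R : Profile N A) (x y : A) :
    nwins (R.topShift x y) x y = nwins R x y := by
  simp only [nwins, Profile.topShift, WeakOrd.strict_topShift_left]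

theorem nwins_topShift_right (R : Profile N A) (x y : A) :
    nwins (R.topShift x y) y x = nwins R y x := by
  simp only [nwins, Profile.topShift, WeakOrd.strict_topShift_right]

theorem nwins_eq_zero {R : Profile N A} {x y : A} (h : ∀ i, (R i).strict y x) :
    nwins R x y = 0 := by
  have : IsEmpty {i // (R i).strict x y} := ⟨fun i => WeakOrd.strict_asymm (h i) i.2⟩
  exact Nat.card_of_isEmpty

theorem nwins_pos [Finite N] [Nonempty N] {R : Profile N A} {x y : A}
    (h : ∀ i, (R i).strict x y) : 0 < nwins R x y := by
  have : Nonempty {i // (R i).strict x y} := ‹Nonempty N›.map fun i => ⟨i, h i⟩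
  exact Nat.card_pos

theorem nwins_mono [Finite N] {R Q : Profile N A} {x y z w : A}
    (h : ∀ i, (R i).strict x y → (Q i).strict z w) : nwins R x y ≤ nwins Q z w :=
  Set.ncard_le_ncard (s := {i | (R i).strict x y}) (t := {i | (Q i).strict z w}) h

theorem nwins_lt_nwins [Finite N] {R Q : Profile N A} {x y z w : A}
    (h : ∀ i, (R i).strict x y → (Q i).strict z w)
    (h' : ∃ i, ¬ (R i).strict x y ∧ (Q i).strict z w) : nwins R x y < nwins Q z w := by
  obtain ⟨i, hi, hi'⟩ := h'
  exact Set.ncard_lt_ncard (s := {i | (R i).strict x y}) (t := {i | (Q i).strict z w})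
    ⟨h, fun hs => hi (hs hi')⟩

theorem notMem_CW_of_forall_strict [Finite N] [Nonempty N] {R : Profile N A} {x z : A}
    (h : ∀ i, (R i).strict x z) : z ∉ CW R := by
  intro hz
  have hne : x ≠ z := by
    rintro rfl
    exact (h (Classical.arbitrary N)).2 (h (Classical.arbitrary N)).1
  have := hz x hne
  rw [nwins_eq_zero h] at this
  exact (nwins_pos h).not_ge this

theorem mem_CW_of_top {R : Profile N A} {x y : A}
    (h : ∀ z, z ≠ x → z ≠ y → ∀ i, (R i).strict x z) (hxy : nwins R y x ≤ nwins R x y) :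
    x ∈ CW R := by
  intro w hw
  by_cases hwy : w = y
  · rwa [hwy]
  · rw [nwins_eq_zero (h w hw hwy)]
    exact Nat.zero_le _

theorem CW_inter_top_nonempty {R : Profile N A} {x y : A}
    (h : ∀ z, z ≠ x → z ≠ y → ∀ i, (R i).strict x z ∧ (R i).strict y z) :
    (CW R ∩ {x, y}).Nonempty := by
  rcases le_total (nwins R y x) (nwins R x y) with hle | hle
  · exact ⟨x, mem_CW_of_top (fun z hx hy i => (h z hx hy i).1) hle, by simp⟩
  · exact ⟨y, mem_CW_of_top (fun z hy hx i => (h z hx hy i).2) hle, by simp⟩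

theorem isTwoProfile_topShift (R : Profile N A) {x y : A} (hxy : x ≠ y) :
    IsTwoProfile (R.topShift x y) :=
  ⟨x, y, hxy, fun _ hzx hzy i => (R i).topShift_strict_of_ne hzx hzy⟩

theorem mem_CW_topShift {R : Profile N A} {x y : A} (hxy : x ≠ y) :
    x ∈ CW (R.topShift x y) ↔ nwins R y x ≤ nwins R x y := by
  rw [← nwins_topShift_left R x y, ← nwins_topShift_right R x y]
  exact ⟨fun h => h y hxy.symm,
    mem_CW_of_top fun z hzx hzy i => ((R i).topShift_strict_of_ne hzx hzy).1⟩

theorem IsTwoProfile.comp_perm {R : Profile N A} (hR : IsTwoProfile R) (π : Equiv.Perm N) :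
    IsTwoProfile fun i => R (π i) := by
  obtain ⟨x, y, hxy, h⟩ := hR
  exact ⟨x, y, hxy, fun z hzx hzy i => h z hzx hzy (π i)⟩

theorem IsTwoProfile.map {R : Profile N A} (hR : IsTwoProfile R) (σ : Equiv.Perm A) :
    IsTwoProfile (Profile.map σ R) := by
  obtain ⟨x, y, hxy, h⟩ := hR
  refine ⟨σ x, σ y, σ.injective.ne hxy, fun z hzx hzy i => ?_⟩
  have := h (σ.symm z) (fun hz => hzx (by simp [← hz])) (fun hz => hzy (by simp [← hz])) i
  simpa [Profile.map, WeakOrd.map, WeakOrd.strict] using this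

theorem CW_comp_perm (R : Profile N A) (π : Equiv.Perm N) : CW (fun i => R (π i)) = CW R := by
  have h (x y : A) : nwins (fun i => R (π i)) x y = nwins R x y :=
    Nat.card_congr (π.subtypeEquiv fun _ => Iff.rfl)
  simp only [CW, h]

theorem CW_map (R : Profile N A) (σ : Equiv.Perm A) : CW (Profile.map σ R) = σ '' CW R := by
  ext x
  rw [Equiv.image_eq_preimage_symm]
  refine ⟨fun h y hy => ?_, fun h y hy => h (σ.symm y) (σ.symm.injective.ne hy)⟩
  have := h (σ y) (fun hy' => hy (by simp [← hy']))
  simpa [nwins, Profile.map, WeakOrd.map, WeakOrd.strict] using this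

theorem C1_of_isTwoProfile {R : Profile N A} (hR : IsTwoProfile R) : C1 R = CW R := if_pos hR

theorem C1_of_not_isTwoProfile {R : Profile N A} (hR : ¬ IsTwoProfile R) : C1 R = Set.univ :=
  if_neg hR

theorem C1_topShift (R : Profile N A) {x y : A} (hxy : x ≠ y) :
    C1 (R.topShift x y) = CW (R.topShift x y) :=
  C1_of_isTwoProfile (isTwoProfile_topShift R hxy)

theorem C1_nonempty [Nonempty A] (R : Profile N A) : (C1 R).Nonempty := by
  by_cases hR : IsTwoProfile R
  · rw [C1_of_isTwoProfile hR]
    obtain ⟨x, y, -, h⟩ := hR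
    exact (CW_inter_top_nonempty h).mono Set.inter_subset_left
  · rw [C1_of_not_isTwoProfile hR]
    exact Set.univ_nonempty

theorem weakTopConsistency_C1 : WeakTopConsistency (C1 (N := N) (A := A)) := by
  intro R x hx
  by_cases hR : IsTwoProfile R
  · rw [C1_of_isTwoProfile hR]
    intro y hy
    have := hx y hy
    rwa [C1_topShift R hy.symm, mem_CW_topShift hy.symm] at this
  · rw [C1_of_not_isTwoProfile hR]
    exact Set.mem_univ x

theorem topAnonymity_C1 : TopAnonymity (C1 (N := N) (A := A)) := by
  intro R hR π
  rw [C1_of_isTwoProfile hR, C1_of_isTwoProfile (hR.comp_perm π), CW_comp_perm]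

theorem topNeutrality_C1 : TopNeutrality (C1 (N := N) (A := A)) := by
  intro R hR σ
  rw [C1_of_isTwoProfile hR, C1_of_isTwoProfile (hR.map σ), CW_map]

theorem Improves.strict_of_strict {R Q : Profile N A} {x z : A} (h : Improves R Q x z) (i : N)
    (w : A) (hw : (Q i).strict w x) : (R i).strict w x := by
  rw [← WeakOrd.not_rel_iff_strict] at hw ⊢
  intro hxw
  by_cases hwx : (R i).rel w x
  · exact hw ((h.1 i w).2 ⟨hxw, hwx⟩)
  · exact hw ((h.1 i w).1 ⟨hxw, hwx⟩).1

theorem topMonotonicity_C1 [Finite N] : TopMonotonicity (C1 (N := N) (A := A)) := by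
  intro R Q x y z hxy hzx hx h
  rw [C1_topShift R hxy, mem_CW_topShift hxy] at hx
  rw [C1_topShift Q hxy, mem_CW_topShift hxy]
  have hyx : nwins Q y x ≤ nwins R y x := nwins_mono fun i => h.strict_of_strict i y
  refine ⟨hyx.trans (hx.trans (nwins_mono fun i => (h.1 i y).1)), fun hz => ?_⟩
  obtain ⟨i, hi, hi'⟩ := h.2
  by_cases hzy : z = y
  · subst hzy
    have hlt : nwins R x z < nwins Q x z :=
      nwins_lt_nwins (fun j => (h.1 j z).1) ⟨i, fun hs => hs.2 hi, hi'⟩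
    have hle := hz x hxy
    rw [nwins_topShift_left, nwins_topShift_right] at hle
    omega
  · have : Nonempty N := ⟨i⟩
    exact notMem_CW_of_forall_strict
      (fun j => ((Q j).topShift_strict_of_ne hzx hzy).1) hz

theorem topRationality_C1 : TopRationality (C1 (N := N) (A := A)) := by
  intro R x y hxy
  rw [C1_topShift R hxy]
  exact CW_inter_top_nonempty fun z hzx hzy i => (R i).topShift_strict_of_ne hzx hzy

/-- The weak order with `a` on top and all other alternatives tied below. -/
def WeakOrd.singleTop (a : A) : WeakOrd A where
  rel x y := y = a → x = a
  total x y := by tauto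
  trans x y z hxy hyz := hxy ∘ hyz

theorem WeakOrd.strict_singleTop {a x y : A} :
    (singleTop a).strict x y ↔ x = a ∧ y ≠ a := by
  simp only [strict, singleTop]
  tauto

theorem not_isTwoProfile_singleTop [Fintype A] [Nonempty N] (hA : 3 ≤ Fintype.card A) (a : A) :
    ¬ IsTwoProfile fun _ : N => WeakOrd.singleTop a := by
  classical
  rintro ⟨x, y, hxy, h⟩
  obtain ⟨z, hz⟩ := Finset.exists_mem_notMem_of_card_lt_card (s := {x, y}) (t := Finset.univ)
    (Finset.card_le_two.trans_lt (by rwa [Finset.card_univ]))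
  simp only [Finset.mem_insert, Finset.mem_singleton, not_or] at hz
  have := h z hz.2.1 hz.2.2 (Classical.arbitrary N)
  simp only [WeakOrd.strict_singleTop] at this
  exact hxy (this.1.1.trans this.2.1.symm)

theorem CW_singleTop [Finite N] [Nonempty N] (a : A) :
    CW (fun _ : N => WeakOrd.singleTop a) = {a} := by
  ext x
  refine ⟨fun hx => ?_, ?_⟩
  · by_contra hxa
    exact notMem_CW_of_forall_strict (x := a)
      (fun _ => WeakOrd.strict_singleTop.2 ⟨rfl, hxa⟩) hx
  · rintro rfl y hy
    rw [nwins_eq_zero fun _ => WeakOrd.strict_singleTop.2 ⟨rfl, hy⟩]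
    exact Nat.zero_le _

theorem not_condorcetConsistent_C1 [Finite N] [Nonempty N] [Fintype A]
    (hA : 3 ≤ Fintype.card A) : ¬ CondorcetConsistent (C1 (N := N) (A := A)) := by
  intro hC
  obtain ⟨a, b, hab⟩ := Fintype.exists_pair_of_one_lt_card (by omega : 1 < Fintype.card A)
  have h := hC (fun _ => WeakOrd.singleTop a) (by simp [CW_singleTop])
  rw [C1_of_not_isTwoProfile (not_isTwoProfile_singleTop hA a), CW_singleTop] at h
  exact hab (h ▸ Set.mem_univ b : b ∈ ({a} : Set A)).symm

end TopPairs

/-- TC cannot be dropped: `C₁` is an SDR satisfying WTC, TA, TN,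
TM and TR but it is not Condorcet-consistent. -/
theorem stmt_8 {N A : Type*} [Fintype N] [Fintype A]
    (hN : 2 ≤ Fintype.card N) (hA : 3 ≤ Fintype.card A) :
    (∀ R : Profile N A, (C1 R).Nonempty) ∧
    WeakTopConsistency (C1 (N := N) (A := A)) ∧
    TopAnonymity (C1 (N := N) (A := A)) ∧
    TopNeutrality (C1 (N := N) (A := A)) ∧
    TopMonotonicity (C1 (N := N) (A := A)) ∧
    TopRationality (C1 (N := N) (A := A)) ∧
    ¬ CondorcetConsistent (C1 (N := N) (A := A)) := by
  have : Nonempty N := Fintype.card_pos_iff.1 (by omega)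
  have : Nonempty A := Fintype.card_pos_iff.1 (by omega)
  exact ⟨C1_nonempty, weakTopConsistency_C1, topAnonymity_C1, topNeutrality_C1,
    topMonotonicity_C1, topRationality_C1, not_condorcetConsistent_C1 hA⟩
end
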